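/- Let C be a permutation-invariant partition of the player set of a finite normal-form game with identical interests. Then every internally chain transitive set of the joint CT-ECFP differential inclusion q̇ ∈ BR(q̄) − q is contained in the set MCE of mean-centric equilibria. -/

import Mathlib

open MeasureTheory Filter Topology

noncomputable section

namespace ECFP

variable {ι A κ : Type*}

/-- The mixed-strategy simplex over a finite action set `Y` inside the action universe `A`. -/
def simplex (Y : Finset A) : Set (A → ℝ) :=
  {p | (∀ a, 0 ≤ p a) ∧ (∀ a, a ∉ Y → p a = 0) ∧ ∑ a ∈ Y, p a = 1}

/-- The space `Δⁿ` of joint mixed strategies. -/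
def Delta (Y : ι → Finset A) : Set (ι → A → ℝ) :=
  {p | ∀ i, p i ∈ simplex (Y i)}

variable [Fintype ι] [DecidableEq ι] [Fintype A] [DecidableEq κ]

/-- The mixed extension of the common utility `u`:
`U(p₁,…,pₙ) = ∑_y u(y) p₁(y₁)⋯pₙ(yₙ)`. -/
def U (u : (ι → A) → ℝ) (p : ι → A → ℝ) : ℝ :=
  ∑ y : ι → A, u y * ∏ i, p i (y i)

/-- The `ε`-best-response set of player `i` against the joint strategy `p`
(only the components `p_{-i}` matter, since player `i`'s component is overwritten):
`{pᵢ ∈ Δᵢ : U(pᵢ,p_{-i}) ≥ U(qᵢ,p_{-i}) - ε  ∀ qᵢ ∈ Δᵢ}`. -/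
def BRi (Y : ι → Finset A) (u : (ι → A) → ℝ) (ε : ℝ) (p : ι → A → ℝ) (i : ι) :
    Set (A → ℝ) :=
  {pi | pi ∈ simplex (Y i) ∧
    ∀ qi ∈ simplex (Y i),
      U u (Function.update p i pi) ≥ U u (Function.update p i qi) - ε}

/-- The joint `ε`-best-response set `BR^ε(p) = (BR₁^ε(p_{-1}),…,BRₙ^ε(p_{-n}))`. -/
def BR (Y : ι → Finset A) (u : (ι → A) → ℝ) (ε : ℝ) (p : ι → A → ℝ) :
    Set (ι → A → ℝ) :=
  {b | ∀ i, b i ∈ BRi Y u ε p i}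

/-- The profile obtained from `y` by swapping the strategies of players `i` and `j`. -/
def swapStrat (y : ι → A) (i j : ι) : ι → A :=
  Function.update (Function.update y i (y j)) j (y i)

/-- `cls : ι → κ` encodes a permutation-invariant partition of the player set (the classes
are the fibers of `cls`): players in the same class have the same action set, and the utility
is invariant under swapping the strategies of two same-class players in any strategy profile. -/
def PermInvariant (Y : ι → Finset A) (u : (ι → A) → ℝ) (cls : ι → κ) : Prop :=
  ∀ i j : ι, cls i = cls j →
    Y i = Y j ∧ ∀ y : ι → A, (∀ k, y k ∈ Y k) → u (swapStrat y i j) = u y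

/-- The equivalence class (as a finset of players) of player `i`. -/
def cluster (cls : ι → κ) (i : ι) : Finset ι :=
  Finset.univ.filter (fun j => cls j = cls i)

/-- The centroid distribution `p̄`: player `i` is assigned the average of the strategies of
the players in `i`'s class. -/
def centroid (cls : ι → κ) (p : ι → A → ℝ) : ι → A → ℝ :=
  fun i => ((cluster cls i).card : ℝ)⁻¹ • ∑ j ∈ cluster cls i, p j

/-- A joint strategy is class-constant if same-class players use identical strategies. -/
def classConst (cls : ι → κ) (p : ι → A → ℝ) : Prop :=
  ∀ i j, cls i = cls j → p i = p j

/-- The set of Nash equilibria. -/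
def NE (Y : ι → Finset A) (u : (ι → A) → ℝ) : Set (ι → A → ℝ) :=
  {p | p ∈ Delta Y ∧ ∀ i, ∀ qi ∈ simplex (Y i),
    U u (Function.update p i qi) ≤ U u p}

/-- The set of symmetric Nash equilibria relative to the partition `cls`. -/
def SNE (Y : ι → Finset A) (u : (ι → A) → ℝ) (cls : ι → κ) : Set (ι → A → ℝ) :=
  {p | p ∈ NE Y u ∧ classConst cls p}

/-- The set of mean-centric equilibria relative to the partition `cls`:
`U(pᵢ, p̄_{-i}) ≥ U(pᵢ', p̄_{-i})` for all `pᵢ' ∈ Δᵢ` and all `i`. -/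
def MCE (Y : ι → Finset A) (u : (ι → A) → ℝ) (cls : ι → κ) : Set (ι → A → ℝ) :=
  {p | p ∈ Delta Y ∧ ∀ i, ∀ qi ∈ simplex (Y i),
    U u (Function.update (centroid cls p) i qi)
      ≤ U u (Function.update (centroid cls p) i (p i))}

/-- `V(p) = (1/n) ∑ᵢ U(pᵢ, p̄_{-i})`. -/
def Vfun (u : (ι → A) → ℝ) (cls : ι → κ) (p : ι → A → ℝ) : ℝ :=
  (Fintype.card ι : ℝ)⁻¹ * ∑ i, U u (Function.update (centroid cls p) i (p i))

/-- A discrete-time ECFP process w.r.t. `(Γ, 𝒞)`: `q(1) = a(1)`,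
`q(t+1) = q(t) + γₜ (a(t+1) − q(t))` and `a(t+1) ∈ BR^{εₜ}(q̄(t))` for all `t`
(time is indexed by `ℕ`, i.e. `t = 0` plays the role of `t = 1` in the paper). -/
structure IsECFP (Y : ι → Finset A) (u : (ι → A) → ℝ) (cls : ι → κ)
    (γ ε : ℕ → ℝ) (a q : ℕ → ι → A → ℝ) : Prop where
  a_init_mem : a 0 ∈ Delta Y
  q_mem : ∀ t, q t ∈ Delta Y
  init : q 0 = a 0
  step : ∀ t, q (t + 1) = q t + γ t • (a (t + 1) - q t)
  br : ∀ t, a (t + 1) ∈ BR Y u (ε t) (centroid cls (q t))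

/-- A solution of the differential inclusion `ẋ ∈ F(x)` taking values in `Δⁿ`:
an everywhere-`Δⁿ`-valued trajectory on `[0,∞)` which is the integral of a locally
integrable selection `g(t) ∈ F(x(t))` (a.e.). -/
def IsSolution (Y : ι → Finset A) (F : (ι → A → ℝ) → Set (ι → A → ℝ))
    (x : ℝ → ι → A → ℝ) : Prop :=
  (∀ t : ℝ, 0 ≤ t → x t ∈ Delta Y) ∧
  ∃ g : ℝ → ι → A → ℝ,
    LocallyIntegrableOn g (Set.Ici (0 : ℝ)) ∧
    (∀ᵐ t ∂(volume.restrict (Set.Ici (0 : ℝ))), g t ∈ F (x t)) ∧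
    ∀ t : ℝ, 0 ≤ t → x t = x 0 + ∫ s in Set.Ioc (0 : ℝ) t, g s

/-- Right-hand side of the joint CT-ECFP differential inclusion `q̇ ∈ BR(q̄) − q`. -/
def Fjoint (Y : ι → Finset A) (u : (ι → A) → ℝ) (cls : ι → κ)
    (q : ι → A → ℝ) : Set (ι → A → ℝ) :=
  (fun b => b - q) '' BR Y u 0 (centroid cls q)

/-- Right-hand side of the centroid CT-ECFP differential inclusion `ẏ ∈ BR(y) − y`. -/
def Fcent (Y : ι → Finset A) (u : (ι → A) → ℝ)
    (y : ι → A → ℝ) : Set (ι → A → ℝ) :=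
  (fun b => b - y) '' BR Y u 0 y

/-- The ω-limit set of a continuous-time trajectory: all limits of sequences
`x(t_k)` with `t_k → ∞`. -/
def omegaLimitSet (x : ℝ → ι → A → ℝ) : Set (ι → A → ℝ) :=
  {p | ∃ tk : ℕ → ℝ, Tendsto tk atTop atTop ∧ Tendsto (fun k => x (tk k)) atTop (𝓝 p)}

/-- The set of limit points of a (discrete-time) sequence. -/
def seqLimitPoints (q : ℕ → ι → A → ℝ) : Set (ι → A → ℝ) :=
  {p | ∃ φ : ℕ → ℕ, StrictMono φ ∧ Tendsto (fun k => q (φ k)) atTop (𝓝 p)}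

/-- A compact set `X ⊆ Δⁿ` is internally chain transitive for the inclusion `ẋ ∈ F(x)`:
any two points of `X` can be joined, for every `ε > 0` and `T > 0`, by finitely many
solution pieces of duration `> T` staying in `X`, with jumps of size `≤ ε`. -/
def InternallyChainTransitive (Y : ι → Finset A)
    (F : (ι → A → ℝ) → Set (ι → A → ℝ)) (X : Set (ι → A → ℝ)) : Prop :=
  IsCompact X ∧ X ⊆ Delta Y ∧
  ∀ ξ ∈ X, ∀ η ∈ X, ∀ ε : ℝ, 0 < ε → ∀ T : ℝ, 0 < T →
    ∃ k : ℕ, 0 < k ∧ ∃ x : ℕ → ℝ → ι → A → ℝ, ∃ tt : ℕ → ℝ,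
      (∀ i < k, IsSolution Y F (x i)) ∧
      (∀ i < k, T < tt i) ∧
      (∀ i < k, ∀ s : ℝ, 0 ≤ s → s ≤ tt i → x i s ∈ X) ∧
      (∀ i, i + 1 < k → ‖x i (tt i) - x (i + 1) 0‖ ≤ ε) ∧
      ‖x 0 0 - ξ‖ ≤ ε ∧ ‖x (k - 1) (tt (k - 1)) - η‖ ≤ ε

set_option linter.unusedSectionVars false

theorem mapBaseChange_injective_of_formallySmooth (R S T : Type*) [CommRing R] [CommRing S]
    [CommRing T] [Algebra R S] [Algebra R T] [Algebra S T] [IsScalarTower R S T]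
    [Algebra.FormallySmooth S T] :
    Function.Injective (KaehlerDifferential.mapBaseChange R S T) := by
  rw [injective_iff_map_eq_zero]
  intro x hx
  obtain ⟨y, rfl⟩ := (Algebra.H1Cotangent.exact_δ_mapBaseChange R S T x).mp hx
  have : Subsingleton (Algebra.H1Cotangent S T) :=
    Algebra.FormallySmooth.subsingleton_h1Cotangent
  rw [Subsingleton.elim y 0, map_zero]

open scoped TensorProduct in
/-- In characteristic zero, an element with vanishing differential is algebraic. -/
theorem isAlgebraic_of_D_eq_zero {k K : Type*} [Field k] [CharZero k] [Field K] [Algebra k K]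
    [Algebra.EssFiniteType k K] {a : K} (ha : KaehlerDifferential.D k K a = 0) :
    IsAlgebraic k a := by
  by_contra htr
  let : Algebra (Polynomial k) K := (Polynomial.aeval a).toAlgebra
  have hX : algebraMap (Polynomial k) K Polynomial.X = a := Polynomial.aeval_X a
  have : IsScalarTower k (Polynomial k) K :=
    .of_algebraMap_eq fun r ↦ (Polynomial.aeval_C a r).symm
  have : FaithfulSMul (Polynomial k) K :=
    (faithfulSMul_iff_algebraMap_injective _ _).mpr
      (transcendental_iff_injective.mp htr)
  let : Algebra (FractionRing (Polynomial k)) K := FractionRing.liftAlgebra _ K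
  have : IsScalarTower k (FractionRing (Polynomial k)) K := IsScalarTower.to₁₃₄ _ (Polynomial k) _ _
  have : Algebra.EssFiniteType (FractionRing (Polynomial k)) K := .of_comp k _ _
  have : CharZero (FractionRing (Polynomial k)) := charZero_of_injective_algebraMap
    (algebraMap k (FractionRing (Polynomial k))).injective
  have : Algebra.FormallySmooth (Polynomial k) (FractionRing (Polynomial k)) :=
    .of_isLocalization (nonZeroDivisors _)
  have : Algebra.FormallySmooth (Polynomial k) K := .comp _ (FractionRing (Polynomial k)) _
  have h1 : (1 : K) ⊗ₜ[Polynomial k] KaehlerDifferential.D k (Polynomial k) Polynomial.X = 0 := by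
    apply mapBaseChange_injective_of_formallySmooth k (Polynomial k) K
    rw [map_zero, KaehlerDifferential.mapBaseChange_tmul, KaehlerDifferential.map_D, hX, ha,
      smul_zero]
  have h2 := congrArg (TensorProduct.rid (Polynomial k) K ∘
    (KaehlerDifferential.polynomialEquiv k).toLinearMap.lTensor K) h1
  simp at h2

theorem derivation_aeval_eq_sum_pderiv {k K M σ : Type*} [Fintype σ] [CommRing k] [CommRing K]
    [Algebra k K] [AddCommGroup M] [Module k M] [Module K M] [IsScalarTower k K M]
    (D : Derivation k K M) (x : σ → K) (f : MvPolynomial σ k) :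
    D (MvPolynomial.aeval x f) =
      ∑ i, MvPolynomial.aeval x (MvPolynomial.pderiv i f) • D (x i) := by
  classical
  induction f using MvPolynomial.induction_on with
  | C r => simp
  | add p q hp hq => simp [hp, hq, add_smul, Finset.sum_add_distrib]
  | mul_X p i hp =>
    simp only [map_mul, MvPolynomial.aeval_X, Derivation.leibniz, hp, smul_eq_mul, map_add,
      MvPolynomial.pderiv_X, add_smul, Finset.sum_add_distrib, Finset.smul_sum, mul_smul]
    congr 1
    simp [Pi.single_apply, Finset.sum_ite_eq]

open MvPolynomial in
/-- The algebraic Sard theorem: a polynomial has finitely many critical values. -/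
theorem finite_criticalValues {k σ : Type*} [Field k] [CharZero k] [Fintype σ]
    (f : MvPolynomial σ k) :
    {v | ∃ x : σ → k, (∀ i, eval x (pderiv i f) = 0) ∧ eval x f = v}.Finite := by
  set I : Ideal (MvPolynomial σ k) := Ideal.span (Set.range fun i ↦ pderiv i f) with hI
  have key : ∀ P ∈ I.minimalPrimes, ∃ g : Polynomial k, g ≠ 0 ∧ Polynomial.aeval f g ∈ P := by
    intro P hP
    have : P.IsPrime := hP.1.1
    let R := MvPolynomial σ k ⧸ P
    let φ : MvPolynomial σ k →ₐ[k] FractionRing R :=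
      (IsScalarTower.toAlgHom k R (FractionRing R)).comp (Ideal.Quotient.mkₐ k P)
    have hφ : ∀ g, φ g = 0 ↔ g ∈ P := fun g ↦
      (map_eq_zero_iff _ (IsFractionRing.injective R (FractionRing R))).trans
        Ideal.Quotient.eq_zero_iff_mem
    have hφ' : φ = aeval fun i ↦ φ (X i) := by ext; simp
    have : IsAlgebraic k (φ f) := by
      apply isAlgebraic_of_D_eq_zero
      rw [hφ', derivation_aeval_eq_sum_pderiv]
      refine Finset.sum_eq_zero fun i _ ↦ ?_
      rw [← hφ', (hφ _).mpr (hP.1.2 (Ideal.subset_span ⟨i, rfl⟩)), zero_smul]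
    obtain ⟨g, hg, h⟩ := this
    exact ⟨g, hg, (hφ _).mp (by rwa [← Polynomial.aeval_algHom_apply])⟩
  choose! g hg0 hg using key
  have hfin := I.finite_minimalPrimes_of_isNoetherianRing
  set G : Polynomial k := ∏ P ∈ hfin.toFinset, g P with hG
  have hG0 : G ≠ 0 := Finset.prod_ne_zero_iff.mpr fun P hP ↦ hg0 P (by simpa using hP)
  have hrad : Polynomial.aeval f G ∈ I.radical := by
    rw [← Ideal.sInf_minimalPrimes, Ideal.mem_sInf]
    intro P hP
    rw [hG, map_prod]
    exact Ideal.mem_of_dvd _ (Finset.dvd_prod_of_mem _ (hfin.mem_toFinset.mpr hP)) (hg P hP)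
  refine (G.finite_setOfPred_isRoot hG0).subset ?_
  rintro _ ⟨x, hx, rfl⟩
  obtain ⟨n, hn⟩ := hrad
  have hle : I ≤ RingHom.ker (eval x) := by
    rw [hI, Ideal.span_le]
    rintro _ ⟨i, rfl⟩
    exact hx i
  have h0 := hle hn
  rw [RingHom.mem_ker, map_pow] at h0
  have h1 : aeval x (Polynomial.aeval f G) = 0 := by
    rw [aeval_eq_eval]
    exact eq_zero_of_pow_eq_zero h0
  rw [← Polynomial.aeval_algHom_apply] at h1
  simpa [aeval_eq_eval, Polynomial.IsRoot] using h1

/-- A Lyapunov function `W` that grows at rate `G ≥ 0` along solutions and takes finitely many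
values on the zeros of `G` forces `G = 0` on internally chain transitive sets. -/
theorem eq_zero_of_chainTransitive_of_lyapunov {E : Type*} [NormedAddCommGroup E] {X : Set E}
    (hX : IsCompact X) {W G : E → ℝ} (hW : Continuous W) (hG : Continuous G)
    (hG0 : ∀ q ∈ X, 0 ≤ G q) (hfin : (W '' {q | q ∈ X ∧ G q = 0}).Finite)
    {S : (ℝ → E) → Prop} (hScont : ∀ x, S x → ContinuousOn x (Set.Ici 0))
    (hS : ∀ x, S x → ∀ t, 0 ≤ t → W (x t) - W (x 0) = ∫ s in (0 : ℝ)..t, G (x s))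
    (hchain : ∀ ξ ∈ X, ∀ η ∈ X, ∀ ε : ℝ, 0 < ε → ∀ T : ℝ, 0 < T →
      ∃ k : ℕ, 0 < k ∧ ∃ x : ℕ → ℝ → E, ∃ tt : ℕ → ℝ,
        (∀ i < k, S (x i)) ∧ (∀ i < k, T < tt i) ∧
        (∀ i < k, ∀ s : ℝ, 0 ≤ s → s ≤ tt i → x i s ∈ X) ∧
        (∀ i, i + 1 < k → ‖x i (tt i) - x (i + 1) 0‖ ≤ ε) ∧
        ‖x 0 0 - ξ‖ ≤ ε ∧ ‖x (k - 1) (tt (k - 1)) - η‖ ≤ ε) :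
    ∀ ξ ∈ X, G ξ = 0 := by
  have hint : ∀ x, S x → ∀ s t, 0 ≤ s → s ≤ t →
      IntervalIntegrable (fun r ↦ G (x r)) volume s t := by
    intro x hx s t hs hst
    refine ContinuousOn.intervalIntegrable_of_Icc hst (hG.comp_continuousOn ?_)
    exact (hScont x hx).mono fun r hr ↦ hs.trans hr.1
  have hsub : ∀ x, S x → ∀ s t, 0 ≤ s → s ≤ t →
      W (x t) - W (x s) = ∫ r in s..t, G (x r) := by
    intro x hx s t hs hst
    rw [← intervalIntegral.integral_interval_sub_left (hint x hx 0 t le_rfl (hs.trans hst))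
      (hint x hx 0 s le_rfl hs), ← hS x hx t (hs.trans hst), ← hS x hx s hs]
    ring
  have hmono : ∀ x, S x → ∀ t, (∀ r, 0 ≤ r → r ≤ t → x r ∈ X) → ∀ s, 0 ≤ s → ∀ s', s ≤ s' →
      s' ≤ t → W (x s) ≤ W (x s') := by
    intro x hx t hmem s hs s' hss' hs't
    have := intervalIntegral.integral_nonneg (μ := volume) hss' fun r hr ↦
      hG0 (x r) (hmem r (hs.trans hr.1) (hr.2.trans hs't))
    linarith [hsub x hx s s' hs hss']
  have hconst : ∀ ξ ∈ X, ∀ η ∈ X, W ξ ≤ W η := by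
    intro ξ hξ η hη
    by_contra! hlt
    obtain ⟨c, hc, hcF⟩ := (Set.Ioo_infinite hlt).exists_notMem_finite hfin
    obtain ⟨δ, hδ, hball⟩ := Metric.nhds_basis_closedBall.mem_iff.mp
      (hfin.isClosed.isOpen_compl.mem_nhds hcF)
    obtain ⟨m, hm, hmG⟩ : ∃ m > 0, ∀ q ∈ X ∩ W ⁻¹' Metric.closedBall c δ, m ≤ G q := by
      have hK : IsCompact (X ∩ W ⁻¹' Metric.closedBall c δ) :=
        hX.inter_right (Metric.isClosed_closedBall.preimage hW)
      have hpos : ∀ q ∈ X ∩ W ⁻¹' Metric.closedBall c δ, 0 < G q := fun q hq ↦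
        lt_of_le_of_ne (hG0 q hq.1) fun h ↦ hball hq.2 ⟨q, ⟨hq.1, h.symm⟩, rfl⟩
      obtain ⟨m, hm, h⟩ := hK.exists_forall_le' hG.continuousOn hpos
      exact ⟨m, hm, h⟩
    have hpiece : ∀ x, S x → ∀ t, 2 * δ / m < t → (∀ r, 0 ≤ r → r ≤ t → x r ∈ X) →
        c - δ ≤ W (x 0) → c + δ ≤ W (x t) := by
      intro x hx t ht hmem h0
      have ht0 : 0 ≤ t := (by positivity : 0 ≤ 2 * δ / m).trans ht.le
      by_contra! hcon
      have hle : ∫ _ in (0 : ℝ)..t, m ≤ ∫ r in (0 : ℝ)..t, G (x r) := by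
        refine intervalIntegral.integral_mono_on ht0 (by simp) (hint x hx 0 t le_rfl ht0) ?_
        intro r hr
        refine hmG _ ⟨hmem r hr.1 hr.2, ?_⟩
        have h1 := hmono x hx t hmem 0 le_rfl r hr.1 hr.2
        have h2 := hmono x hx t hmem r hr.1 t hr.2 le_rfl
        rw [Set.mem_preimage, Real.closedBall_eq_Icc]
        constructor <;> linarith
      rw [← hS x hx t ht0, intervalIntegral.integral_const, sub_zero, smul_eq_mul] at hle
      rw [div_lt_iff₀ hm] at ht
      linarith
    obtain ⟨ε, hε, hunif⟩ := Metric.uniformContinuousOn_iff_le.mp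
      (hX.uniformContinuousOn_of_continuous hW.continuousOn) δ hδ
    obtain ⟨k, hk, x, tt, hsol, htt, hmem, hjump, hstart, hend⟩ :=
      hchain ξ hξ η hη ε hε (2 * δ / m) (by positivity)
    have httnn : ∀ i < k, 0 ≤ tt i := fun i hi ↦
      (by positivity : 0 ≤ 2 * δ / m).trans (htt i hi).le
    have hclose : ∀ a ∈ X, ∀ b ∈ X, ‖a - b‖ ≤ ε → |W a - W b| ≤ δ := fun a ha b hb h ↦ by
      simpa [Real.dist_eq] using hunif a ha b hb (by rwa [dist_eq_norm])
    have hall : ∀ i < k, c + δ ≤ W (x i (tt i)) := by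
      intro i
      induction i with
      | zero =>
        intro hi
        refine hpiece _ (hsol 0 hi) _ (htt 0 hi) (hmem 0 hi) ?_
        have := abs_le.mp (hclose _ (hmem 0 hi 0 le_rfl (httnn 0 hi)) ξ hξ hstart)
        linarith [this.1, hc.2]
      | succ i ih =>
        intro hi
        refine hpiece _ (hsol _ hi) _ (htt _ hi) (hmem _ hi) ?_
        have hi' : i < k := by omega
        have := abs_le.mp (hclose _ (hmem i hi' _ (httnn i hi') le_rfl) _
          (hmem _ hi 0 le_rfl (httnn _ hi)) (hjump i hi))
        linarith [this.2, ih hi']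
    have hk' : k - 1 < k := by omega
    have := abs_le.mp (hclose _ (hmem _ hk' _ (httnn _ hk') le_rfl) η hη hend)
    linarith [this.2, hall _ hk', hc.1]
  intro ξ hξ
  have hcl : IsClosed {q | G q = 0} := isClosed_singleton.preimage hG
  refine hcl.closure_subset (Metric.mem_closure_iff.mpr fun ε hε ↦ ?_)
  obtain ⟨k, hk, x, tt, hsol, htt, hmem, -, hstart, -⟩ :=
    hchain ξ hξ ξ hξ (ε / 2) (by positivity) 1 one_pos
  have ht : 0 < tt 0 := one_pos.trans (htt 0 hk)
  have hx0 := hmem 0 hk 0 le_rfl ht.le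
  refine ⟨x 0 0, ?_, ?_⟩
  · by_contra hne
    have hpos := intervalIntegral.integral_pos ht
      (hG.comp_continuousOn ((hScont _ (hsol 0 hk)).mono fun r hr ↦ hr.1))
      (fun r hr ↦ hG0 _ (hmem 0 hk r hr.1.le hr.2))
      ⟨0, ⟨le_rfl, ht.le⟩, lt_of_le_of_ne (hG0 _ hx0) (Ne.symm hne)⟩
    simp only [Function.comp_apply] at hpos
    have := hS _ (hsol 0 hk) _ ht.le
    linarith [hconst _ (hmem 0 hk _ ht.le le_rfl) _ hx0]
  · rw [dist_comm, dist_eq_norm]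
    linarith

/-- The mixed extension as a continuous multilinear map. -/
def utilityMultilinear (u : (ι → A) → ℝ) :
    ContinuousMultilinearMap ℝ (fun _ : ι ↦ A → ℝ) ℝ :=
  ∑ y : ι → A, u y • (ContinuousMultilinearMap.mkPiAlgebra ℝ ι ℝ).compContinuousLinearMap
    fun i ↦ ContinuousLinearMap.proj (y i)

theorem utilityMultilinear_apply (u : (ι → A) → ℝ) (p : ι → A → ℝ) :
    utilityMultilinear u p = U u p := by
  simp [utilityMultilinear, U]

theorem continuous_U (u : (ι → A) → ℝ) : Continuous (U u) := by
  exact (utilityMultilinear u).cont.congr (utilityMultilinear_apply u)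

theorem U_update_add (u : (ι → A) → ℝ) (y : ι → A → ℝ) (i : ι) (v w : A → ℝ) :
    U u (Function.update y i (v + w)) =
      U u (Function.update y i v) + U u (Function.update y i w) := by
  simp only [← utilityMultilinear_apply, ContinuousMultilinearMap.map_update_add]

theorem U_update_smul (u : (ι → A) → ℝ) (y : ι → A → ℝ) (i : ι) (c : ℝ) (v : A → ℝ) :
    U u (Function.update y i (c • v)) = c * U u (Function.update y i v) := by
  simp only [← utilityMultilinear_apply, ContinuousMultilinearMap.map_update_smul, smul_eq_mul]

theorem U_update_sum {α : Type*} (s : Finset α) (u : (ι → A) → ℝ) (y : ι → A → ℝ) (i : ι)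
    (v : α → A → ℝ) :
    U u (Function.update y i (∑ j ∈ s, v j)) = ∑ j ∈ s, U u (Function.update y i (v j)) := by
  simp only [← utilityMultilinear_apply]
  exact (utilityMultilinear u).toMultilinearMap.map_update_sum s i v y

theorem U_update_eq_sum [DecidableEq A] (u : (ι → A) → ℝ) (y : ι → A → ℝ) (i : ι) (v : A → ℝ) :
    U u (Function.update y i v) = ∑ a, v a * U u (Function.update y i (Pi.single a 1)) := by
  have h : v = ∑ a, v a • (Pi.single a 1 : A → ℝ) := by
    ext b
    simp [Pi.single_apply]
  conv_lhs => rw [h, U_update_sum]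
  simp only [U_update_smul]

/-- The centroid as a continuous linear map. -/
def centroidCLM (cls : ι → κ) : (ι → A → ℝ) →L[ℝ] (ι → A → ℝ) :=
  ContinuousLinearMap.pi fun i ↦
    ((cluster cls i).card : ℝ)⁻¹ • ∑ j ∈ cluster cls i, ContinuousLinearMap.proj j

theorem centroidCLM_apply (cls : ι → κ) (p : ι → A → ℝ) :
    centroidCLM cls p = centroid cls p := by
  ext i a
  simp [centroidCLM, centroid]

theorem continuous_centroid (cls : ι → κ) :
    Continuous (centroid cls : (ι → A → ℝ) → ι → A → ℝ) := by
  exact (centroidCLM (A := A) cls).continuous.congr (centroidCLM_apply cls)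

theorem card_cluster_pos (cls : ι → κ) (i : ι) : 0 < (cluster cls i).card :=
  Finset.card_pos.mpr ⟨i, by simp [cluster]⟩

theorem swapStrat_eq_comp (y : ι → A) (i j : ι) : swapStrat y i j = y ∘ Equiv.swap i j := by
  ext k
  simp only [swapStrat, Function.update_apply, Function.comp_apply, Equiv.swap_apply_def]
  split_ifs <;> simp_all

theorem U_comp_swap {Y : ι → Finset A} {u : (ι → A) → ℝ} {cls : ι → κ}
    (hpi : PermInvariant Y u cls) {p : ι → A → ℝ} (hp : p ∈ Delta Y) {i j : ι}
    (hij : cls i = cls j) : U u (p ∘ Equiv.swap i j) = U u p := by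
  unfold U
  refine Fintype.sum_equiv (Equiv.arrowCongr (Equiv.swap i j) (Equiv.refl A)) _ _ fun y ↦ ?_
  have hprod : ∏ k, (p ∘ Equiv.swap i j) k (y k) =
      ∏ k, p k ((Equiv.arrowCongr (Equiv.swap i j) (Equiv.refl A)) y k) :=
    Fintype.prod_equiv (Equiv.swap i j) _ _ fun k ↦ by simp
  rw [hprod]
  set z := (Equiv.arrowCongr (Equiv.swap i j) (Equiv.refl A)) y with hz
  by_cases hzY : ∀ k, z k ∈ Y k
  · rw [← (hpi i j hij).2 z hzY]
    congr 2
    ext k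
    simp [swapStrat_eq_comp, hz]
  · push Not at hzY
    obtain ⟨k, hk⟩ := hzY
    have : ∏ k, p k (z k) = 0 := Finset.prod_eq_zero (Finset.mem_univ k) ((hp k).2.1 _ hk)
    simp [this]

theorem update_mem_Delta {Y : ι → Finset A} {p : ι → A → ℝ} (hp : p ∈ Delta Y) {i : ι}
    {v : A → ℝ} (hv : v ∈ simplex (Y i)) : Function.update p i v ∈ Delta Y := by
  intro k
  obtain rfl | hk := eq_or_ne k i
  · simpa using hv
  · simpa [hk] using hp k

theorem classConst.U_update_eq {Y : ι → Finset A} {u : (ι → A) → ℝ} {cls : ι → κ}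
    (hpi : PermInvariant Y u cls) {p : ι → A → ℝ} (hp : p ∈ Delta Y) (hc : classConst cls p)
    {i j : ι} (hij : cls i = cls j) {v : A → ℝ} (hv : v ∈ simplex (Y i)) :
    U u (Function.update p j v) = U u (Function.update p i v) := by
  rw [← U_comp_swap hpi (update_mem_Delta hp hv) hij]
  congr 1
  ext1 k
  simp only [Function.update_apply, Function.comp_apply, Equiv.swap_apply_def]
  have := hc i j hij
  split_ifs <;> simp_all

theorem centroid_classConst (cls : ι → κ) (p : ι → A → ℝ) : classConst cls (centroid cls p) := by
  intro i j hij
  simp [centroid, cluster, hij]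

theorem mem_cluster {cls : ι → κ} {i j : ι} : j ∈ cluster cls i ↔ cls j = cls i := by
  simp [cluster]

theorem centroid_mem_Delta {Y : ι → Finset A} {u : (ι → A) → ℝ} {cls : ι → κ}
    (hpi : PermInvariant Y u cls) {p : ι → A → ℝ} (hp : p ∈ Delta Y) :
    centroid cls p ∈ Delta Y := by
  intro i
  have hc : (0 : ℝ) < (cluster cls i).card := by exact_mod_cast card_cluster_pos cls i
  have hY : ∀ j ∈ cluster cls i, p j ∈ simplex (Y i) := fun j hj ↦
    (hpi j i (mem_cluster.mp hj)).1 ▸ hp j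
  refine ⟨fun a ↦ ?_, fun a ha ↦ ?_, ?_⟩
  · simp only [centroid, Pi.smul_apply, Finset.sum_apply, smul_eq_mul]
    exact mul_nonneg (by positivity) (Finset.sum_nonneg fun j hj ↦ (hY j hj).1 a)
  · simp only [centroid, Pi.smul_apply, Finset.sum_apply, smul_eq_mul]
    rw [Finset.sum_eq_zero fun j hj ↦ (hY j hj).2.1 a ha, mul_zero]
  · simp only [centroid, Pi.smul_apply, Finset.sum_apply, smul_eq_mul]
    rw [← Finset.mul_sum, Finset.sum_comm, Finset.sum_congr rfl fun j hj ↦ (hY j hj).2.2]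
    simp [hc.ne']

/-- Averaging within clusters preserves the total. -/
theorem sum_cluster_average (cls : ι → κ) (h : ι → ℝ) :
    ∑ i, ((cluster cls i).card : ℝ)⁻¹ * ∑ j ∈ cluster cls i, h j = ∑ j, h j := by
  have hcl : ∀ i j : ι, j ∈ cluster cls i → cluster cls i = cluster cls j := fun i j hj ↦ by
    simp [cluster, mem_cluster.mp hj]
  calc _ = ∑ i, ∑ j ∈ cluster cls i, ((cluster cls j).card : ℝ)⁻¹ * h j := by
        refine Finset.sum_congr rfl fun i _ ↦ ?_
        rw [Finset.mul_sum]
        exact Finset.sum_congr rfl fun j hj ↦ by rw [hcl i j hj]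
    _ = ∑ j, ∑ i ∈ cluster cls j, ((cluster cls j).card : ℝ)⁻¹ * h j :=
        Finset.sum_comm' fun i j ↦ by simp [mem_cluster, eq_comm]
    _ = ∑ j, h j := by
        refine Finset.sum_congr rfl fun j _ ↦ ?_
        have := card_cluster_pos cls j
        rw [Finset.sum_const, nsmul_eq_mul, mul_inv_cancel_left₀ (by positivity)]

theorem U_update_centroid {Y : ι → Finset A} {u : (ι → A) → ℝ} {cls : ι → κ}
    (hpi : PermInvariant Y u cls) {y b : ι → A → ℝ} (hy : y ∈ Delta Y) (hc : classConst cls y)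
    (hb : b ∈ Delta Y) (i : ι) :
    U u (Function.update y i (centroid cls b i)) =
      ((cluster cls i).card : ℝ)⁻¹ * ∑ j ∈ cluster cls i, U u (Function.update y j (b j)) := by
  rw [centroid, U_update_smul, U_update_sum]
  congr 1
  refine Finset.sum_congr rfl fun j hj ↦ ?_
  exact hc.U_update_eq hpi hy (mem_cluster.mp hj) (hb j)

theorem sum_U_update_centroid {Y : ι → Finset A} {u : (ι → A) → ℝ} {cls : ι → κ}
    (hpi : PermInvariant Y u cls) {y b : ι → A → ℝ} (hy : y ∈ Delta Y) (hc : classConst cls y)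
    (hb : b ∈ Delta Y) :
    ∑ i, U u (Function.update y i (centroid cls b i)) = ∑ i, U u (Function.update y i (b i)) := by
  simp_rw [U_update_centroid hpi hy hc hb]
  exact sum_cluster_average cls fun j ↦ U u (Function.update y j (b j))

/-- The highest payoff player `i` can get against `y`. -/
def maxPayoff [DecidableEq A] {Y : ι → Finset A} (hY : ∀ i, (Y i).Nonempty) (u : (ι → A) → ℝ)
    (i : ι) (y : ι → A → ℝ) : ℝ :=
  (Y i).sup' (hY i) fun a ↦ U u (Function.update y i (Pi.single a 1))

theorem continuous_maxPayoff [DecidableEq A] {Y : ι → Finset A} (hY : ∀ i, (Y i).Nonempty)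
    (u : (ι → A) → ℝ) (i : ι) : Continuous (maxPayoff hY u i) :=
  Continuous.finset_sup'_apply _ fun _ _ ↦
    (continuous_U u).comp (continuous_id.update i continuous_const)

theorem U_update_le_maxPayoff [DecidableEq A] {Y : ι → Finset A} (hY : ∀ i, (Y i).Nonempty)
    (u : (ι → A) → ℝ) (i : ι) (y : ι → A → ℝ) {v : A → ℝ} (hv : v ∈ simplex (Y i)) :
    U u (Function.update y i v) ≤ maxPayoff hY u i y := by
  rw [U_update_eq_sum, ← Finset.sum_subset (Finset.subset_univ (Y i))
    fun a _ ha ↦ by rw [hv.2.1 a ha, zero_mul]]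
  calc _ ≤ ∑ a ∈ Y i, v a * maxPayoff hY u i y := Finset.sum_le_sum fun a ha ↦
        mul_le_mul_of_nonneg_left
          (Finset.le_sup' (fun a ↦ U u (Function.update y i (Pi.single a 1))) ha) (hv.1 a)
    _ = _ := by rw [← Finset.sum_mul, hv.2.2, one_mul]

theorem single_mem_simplex [DecidableEq A] {Y : Finset A} {a : A} (ha : a ∈ Y) :
    (Pi.single a 1 : A → ℝ) ∈ simplex Y := by
  refine ⟨fun b ↦ ?_, fun b hb ↦ ?_, ?_⟩
  · rw [Pi.single_apply]; split_ifs <;> norm_num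
  · exact Pi.single_eq_of_ne (fun h ↦ hb (by rwa [h])) _
  · simp [ha, Pi.single_apply]

theorem U_update_eq_maxPayoff_of_mem_BRi [DecidableEq A] {Y : ι → Finset A}
    (hY : ∀ i, (Y i).Nonempty) {u : (ι → A) → ℝ} {i : ι} {y : ι → A → ℝ} {b : A → ℝ}
    (hb : b ∈ BRi Y u 0 y i) : U u (Function.update y i b) = maxPayoff hY u i y := by
  refine (U_update_le_maxPayoff hY u i y hb.1).antisymm ?_
  refine Finset.sup'_le _ _ fun a ha ↦ ?_
  simpa using hb.2 _ (single_mem_simplex ha)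

/-- The total gain available to the players from deviating against the centroid of `q`. -/
def gain [DecidableEq A] {Y : ι → Finset A} (hY : ∀ i, (Y i).Nonempty) (u : (ι → A) → ℝ)
    (cls : ι → κ) (q : ι → A → ℝ) : ℝ :=
  ∑ i, (maxPayoff hY u i (centroid cls q) - U u (Function.update (centroid cls q) i (q i)))

section gain

variable [DecidableEq A] {Y : ι → Finset A} (hY : ∀ i, (Y i).Nonempty) (u : (ι → A) → ℝ)
    (cls : ι → κ)

theorem continuous_gain : Continuous (gain hY u cls) :=
  continuous_finsetSum _ fun i _ ↦
    ((continuous_maxPayoff hY u i).comp (continuous_centroid cls)).sub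
      ((continuous_U u).comp ((continuous_centroid cls).update i (continuous_apply i)))

theorem gain_nonneg {q : ι → A → ℝ} (hq : q ∈ Delta Y) : 0 ≤ gain hY u cls q :=
  Finset.sum_nonneg fun i _ ↦ sub_nonneg.mpr (U_update_le_maxPayoff hY u i _ (hq i))

variable {u cls}

theorem maxPayoff_eq_of_gain_eq_zero {q : ι → A → ℝ} (hq : q ∈ Delta Y)
    (h : gain hY u cls q = 0) (i : ι) :
    U u (Function.update (centroid cls q) i (q i)) = maxPayoff hY u i (centroid cls q) := by
  have := (Finset.sum_eq_zero_iff_of_nonneg fun i _ ↦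
    sub_nonneg.mpr (U_update_le_maxPayoff hY u i (centroid cls q) (hq i))).mp h i
      (Finset.mem_univ i)
  linarith

theorem mem_MCE_of_gain_eq_zero {q : ι → A → ℝ} (hq : q ∈ Delta Y)
    (h : gain hY u cls q = 0) : q ∈ MCE Y u cls := by
  refine ⟨hq, fun i v hv ↦ ?_⟩
  rw [maxPayoff_eq_of_gain_eq_zero hY hq h]
  exact U_update_le_maxPayoff hY u i _ hv

end gain

theorem centroid_mem_NE_of_mem_MCE {Y : ι → Finset A} {u : (ι → A) → ℝ} {cls : ι → κ}
    (hpi : PermInvariant Y u cls) {q : ι → A → ℝ} (hq : q ∈ MCE Y u cls) :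
    centroid cls q ∈ NE Y u := by
  have hq' := centroid_mem_Delta hpi hq.1
  have hc := centroid_classConst cls q
  refine ⟨hq', fun i v hv ↦ ?_⟩
  have hself := U_update_centroid hpi hq' hc hq.1 i
  rw [Function.update_eq_self] at hself
  have hcard := card_cluster_pos cls i
  rw [hself, inv_mul_eq_div, le_div_iff₀ (by positivity), mul_comm, ← nsmul_eq_mul]
  refine Finset.card_nsmul_le_sum _ _ _ fun j hj ↦ ?_
  have hij := mem_cluster.mp hj
  rw [← hc.U_update_eq hpi hq' hij.symm hv]
  exact hq.2 j v ((hpi j i hij).1 ▸ hv)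

theorem hasDerivAt_eval_update {σ : Type*} [DecidableEq σ] (f : MvPolynomial σ ℝ) (x : σ → ℝ)
    (s : σ) :
    HasDerivAt (fun t ↦ MvPolynomial.eval (Function.update x s t) f)
      (MvPolynomial.eval x (MvPolynomial.pderiv s f)) (x s) := by
  induction f using MvPolynomial.induction_on with
  | C a => simpa using hasDerivAt_const (x s) a
  | add p q hp hq =>
    simp only [map_add]
    exact hp.add hq
  | mul_X p i hp =>
    have hX : HasDerivAt (fun t ↦ Function.update x s t i) ((Pi.single s 1 : σ → ℝ) i) (x s) := by
      obtain rfl | hi := eq_or_ne i s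
      · simpa using hasDerivAt_id' (x i)
      · simpa [hi] using hasDerivAt_const (x s) (x i)
    have hS : MvPolynomial.eval x (MvPolynomial.pderiv s (MvPolynomial.X (R := ℝ) i)) =
        (Pi.single s 1 : σ → ℝ) i := by
      rw [MvPolynomial.pderiv_X, Pi.single_comm]
      obtain rfl | hi := eq_or_ne i s
      · simp
      · simp [hi]
    simp only [map_mul, MvPolynomial.eval_X]
    refine (hp.mul hX).congr_deriv ?_
    rw [Derivation.leibniz, map_add, smul_eq_mul, smul_eq_mul, map_mul, map_mul, hS]
    simp
    ring

/-- The Lagrangian of the mixed extension restricted to the affine hulls of the simplices, with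
the square roots of the probabilities (`Sum.inl`) and the multipliers (`Sum.inr`) as unknowns. -/
def lagrangian (u : (ι → A) → ℝ) : MvPolynomial (ι × A ⊕ ι) ℝ :=
  ∑ y : ι → A, MvPolynomial.C (u y) * ∏ i, MvPolynomial.X (Sum.inl (i, y i)) ^ 2 -
    ∑ i, MvPolynomial.X (Sum.inr i) * (∑ a, MvPolynomial.X (Sum.inl (i, a)) ^ 2 - 1)

theorem eval_lagrangian (u : (ι → A) → ℝ) (x : ι × A ⊕ ι → ℝ) :
    MvPolynomial.eval x (lagrangian u) =
      U u (fun i a ↦ x (Sum.inl (i, a)) ^ 2) -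
        ∑ i, x (Sum.inr i) * (∑ a, x (Sum.inl (i, a)) ^ 2 - 1) := by
  simp [lagrangian, U]

theorem eval_lagrangian_update_inl [DecidableEq A] (u : (ι → A) → ℝ) (x : ι × A ⊕ ι → ℝ) (j : ι)
    (b : A) (t : ℝ) :
    MvPolynomial.eval (Function.update x (Sum.inl (j, b)) t) (lagrangian u) =
      MvPolynomial.eval x (lagrangian u) + (t ^ 2 - x (Sum.inl (j, b)) ^ 2) *
        (U u (Function.update (fun i a ↦ x (Sum.inl (i, a)) ^ 2) j (Pi.single b 1)) -
          x (Sum.inr j)) := by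
  simp only [eval_lagrangian]
  set P : ι → A → ℝ := fun i a ↦ x (Sum.inl (i, a)) ^ 2 with hP
  have hu : (fun i a ↦ Function.update x (Sum.inl (j, b)) t (Sum.inl (i, a)) ^ 2) =
      Function.update P j (P j + (t ^ 2 - P j b) • Pi.single b 1) := by
    ext i a
    by_cases hi : i = j
    · subst hi
      by_cases ha : a = b
      · subst ha; simp
      · simp [ha, hP]
    · simp [hi, hP]
  have hsum : ∀ i, ∑ a, Function.update x (Sum.inl (j, b)) t (Sum.inl (i, a)) ^ 2 =
      ∑ a, P i a + if i = j then t ^ 2 - P j b else 0 := fun i ↦ by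
    have := congrFun hu i
    rw [Finset.sum_congr rfl fun a _ ↦ congrFun this a]
    by_cases hi : i = j
    · subst hi
      simp [Finset.sum_add_distrib, ← Finset.mul_sum]
    · simp [hi]
  rw [hu, U_update_add, U_update_smul, Function.update_eq_self]
  simp only [hsum]
  have hterm : ∀ i, Function.update x (Sum.inl (j, b)) t (Sum.inr i) *
      (∑ a, P i a + (if i = j then t ^ 2 - P j b else 0) - 1) =
      x (Sum.inr i) * (∑ a, P i a - 1) +
        if i = j then x (Sum.inr j) * (t ^ 2 - P j b) else 0 := fun i ↦ by
    rw [Function.update_of_ne (by simp)]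
    split_ifs with h
    · subst h; ring
    · ring
  rw [Finset.sum_congr rfl fun i _ ↦ hterm i, Finset.sum_add_distrib]
  simp only [Finset.sum_ite_eq', Finset.mem_univ, if_true]
  have : P j b = x (Sum.inl (j, b)) ^ 2 := rfl
  rw [this]
  ring

theorem eval_lagrangian_update_inr (u : (ι → A) → ℝ) (x : ι × A ⊕ ι → ℝ) [DecidableEq (ι × A ⊕ ι)]
    (j : ι) (hx : ∑ a, x (Sum.inl (j, a)) ^ 2 = 1) (t : ℝ) :
    MvPolynomial.eval (Function.update x (Sum.inr j) t) (lagrangian u) =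
      MvPolynomial.eval x (lagrangian u) := by
  simp only [eval_lagrangian, ne_eq, reduceCtorEq, not_false_eq_true, Function.update_of_ne]
  congr 1
  refine Finset.sum_congr rfl fun i _ ↦ ?_
  by_cases hi : i = j
  · subst hi; simp [hx]
  · simp [hi]

theorem sum_eq_one_of_mem_simplex {Y : Finset A} {v : A → ℝ} (hv : v ∈ simplex Y) :
    ∑ a, v a = 1 := by
  rw [← hv.2.2]
  exact (Finset.sum_subset (Finset.subset_univ Y) fun a _ ha ↦ hv.2.1 a ha).symm

theorem U_update_single_eq_of_mem_NE [DecidableEq A] {Y : ι → Finset A} {u : (ι → A) → ℝ}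
    {p : ι → A → ℝ} (hp : p ∈ NE Y u) {j : ι} {b : A} (hb : p j b ≠ 0) :
    U u (Function.update p j (Pi.single b 1)) = U u p := by
  have hle : ∀ a, 0 ≤ p j a * (U u p - U u (Function.update p j (Pi.single a 1))) := fun a ↦ by
    by_cases ha : a ∈ Y j
    · exact mul_nonneg ((hp.1 j).1 a)
        (sub_nonneg.mpr (hp.2 j _ (single_mem_simplex ha)))
    · rw [(hp.1 j).2.1 a ha, zero_mul]
  have hsum : ∑ a, p j a * (U u p - U u (Function.update p j (Pi.single a 1))) = 0 := by
    simp only [mul_sub, Finset.sum_sub_distrib, ← Finset.sum_mul,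
      sum_eq_one_of_mem_simplex (hp.1 j), ← U_update_eq_sum, Function.update_eq_self]
    ring
  have := (Finset.sum_eq_zero_iff_of_nonneg fun a _ ↦ hle a).mp hsum b (Finset.mem_univ b)
  rcases mul_eq_zero.mp this with h | h
  · exact absurd h hb
  · linarith

theorem finite_image_U_NE (Y : ι → Finset A) (u : (ι → A) → ℝ) : (U u '' NE Y u).Finite := by
  classical
  refine (finite_criticalValues (lagrangian u)).subset ?_
  rintro _ ⟨p, hp, rfl⟩
  set x : ι × A ⊕ ι → ℝ := Sum.elim (fun z ↦ √(p z.1 z.2)) fun _ ↦ U u p with hx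
  have hsq : ∀ i a, x (Sum.inl (i, a)) ^ 2 = p i a := fun i a ↦ Real.sq_sqrt ((hp.1 i).1 a)
  have hP : (fun i a ↦ x (Sum.inl (i, a)) ^ 2) = p := by ext i a; exact hsq i a
  have hone : ∀ i, ∑ a, x (Sum.inl (i, a)) ^ 2 = 1 := fun i ↦ by
    simp only [hsq, sum_eq_one_of_mem_simplex (hp.1 i)]
  refine ⟨x, ?_, by simp [eval_lagrangian, hone, hP]⟩
  rintro (⟨j, b⟩ | j)
  · have hd := hasDerivAt_eval_update (lagrangian u) x (Sum.inl (j, b))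
    simp only [eval_lagrangian_update_inl, hP] at hd
    have hd' := ((((hasDerivAt_pow 2 (x (Sum.inl (j, b)))).sub_const
      (x (Sum.inl (j, b)) ^ 2)).mul_const
      (U u (Function.update p j (Pi.single b 1)) - x (Sum.inr j))).const_add
      (MvPolynomial.eval x (lagrangian u)))
    rw [hd.unique hd']
    by_cases hb : p j b = 0
    · simp [hx, hb]
    · simp [hx, U_update_single_eq_of_mem_NE hp hb]
  · have hd := hasDerivAt_eval_update (lagrangian u) x (Sum.inr j)
    simp only [eval_lagrangian_update_inr u x j (hone j)] at hd
    exact hd.unique (hasDerivAt_const _ _)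

theorem norm_le_one_of_mem_Delta {Y : ι → Finset A} {p : ι → A → ℝ} (hp : p ∈ Delta Y) :
    ‖p‖ ≤ 1 := by
  refine (pi_norm_le_iff_of_nonneg zero_le_one).mpr fun i ↦
    (pi_norm_le_iff_of_nonneg zero_le_one).mpr fun a ↦ ?_
  rw [Real.norm_of_nonneg ((hp i).1 a), ← sum_eq_one_of_mem_simplex (hp i)]
  exact Finset.single_le_sum (fun a _ ↦ (hp i).1 a) (Finset.mem_univ a)

theorem hasFDerivAt_U (u : (ι → A) → ℝ) (y : ι → A → ℝ) :
    HasFDerivAt (U u) ((utilityMultilinear u).linearDeriv y) y := by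
  rw [← funext (utilityMultilinear_apply u)]
  exact (utilityMultilinear u).hasFDerivAt y

theorem contDiff_U_centroid (u : (ι → A) → ℝ) (cls : ι → κ) :
    ContDiff ℝ 1 fun q : ι → A → ℝ ↦ U u (centroid cls q) := by
  simp only [← utilityMultilinear_apply, ← centroidCLM_apply]
  have h : ContDiff ℝ 1 (centroidCLM (A := A) cls) :=
    (centroidCLM (A := A) cls).contDiff
  exact (utilityMultilinear u).contDiff.comp h

section solution

variable {Y : ι → Finset A} {u : (ι → A) → ℝ} {cls : ι → κ}

/-- The centroid utility grows at rate `gain` along the best-response directions. -/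
theorem linearDeriv_centroid_eq_gain [DecidableEq A] (hY : ∀ i, (Y i).Nonempty)
    (hpi : PermInvariant Y u cls) {q v : ι → A → ℝ} (hq : q ∈ Delta Y)
    (hv : v ∈ Fjoint Y u cls q) :
    (utilityMultilinear u).linearDeriv (centroid cls q) (centroidCLM cls v) =
      gain hY u cls q := by
  obtain ⟨b, hb, rfl⟩ := hv
  have hq' := centroid_mem_Delta hpi hq
  have hc := centroid_classConst cls q
  simp only [map_sub, ContinuousMultilinearMap.linearDeriv_apply, utilityMultilinear_apply,
    centroidCLM_apply]
  rw [sum_U_update_centroid hpi hq' hc fun i ↦ (hb i).1, sum_U_update_centroid hpi hq' hc hq,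
    gain, Finset.sum_sub_distrib]
  simp only [U_update_eq_maxPayoff_of_mem_BRi hY (hb _)]

theorem norm_le_two_of_mem_Fjoint {q v : ι → A → ℝ} (hq : q ∈ Delta Y)
    (hv : v ∈ Fjoint Y u cls q) : ‖v‖ ≤ 2 := by
  obtain ⟨b, hb, rfl⟩ := hv
  have hb' : b ∈ Delta Y := fun i ↦ (hb i).1
  linarith [norm_sub_le b q, norm_le_one_of_mem_Delta hq, norm_le_one_of_mem_Delta hb']

variable {x : ℝ → ι → A → ℝ}

theorem IsSolution.lipschitzOnWith (hx : IsSolution Y (Fjoint Y u cls) x) :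
    LipschitzOnWith 2 x (Set.Ici 0) := by
  obtain ⟨hxD, g, hg, hgF, hxg⟩ := hx
  have hint : ∀ t, 0 ≤ t → IntervalIntegrable g volume 0 t := fun t ht ↦
    ((hg.integrableOn_compact_subset Set.Icc_subset_Ici_self isCompact_Icc).mono_set
      (by rw [Set.uIcc_of_le ht])).intervalIntegrable
  refine LipschitzOnWith.of_dist_le_mul fun s hs t ht ↦ ?_
  have h : x s - x t = ∫ r in t..s, g r := by
    rw [hxg s hs, hxg t ht, ← intervalIntegral.integral_of_le hs,
      ← intervalIntegral.integral_of_le ht, add_sub_add_left_eq_sub,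
      intervalIntegral.integral_interval_sub_left (hint s hs) (hint t ht)]
  rw [dist_eq_norm, h, Real.dist_eq]
  refine intervalIntegral.norm_integral_le_of_norm_le_const_ae ?_
  filter_upwards [(ae_restrict_iff' measurableSet_Ici).mp hgF] with r hr hrI
  have hr0 : 0 ≤ r := (le_min ht hs).trans (Set.uIoc_subset_uIcc hrI).1
  exact norm_le_two_of_mem_Fjoint (hxD r hr0) (hr hr0)

theorem IsSolution.ae_hasDerivAt [DecidableEq A] (hY : ∀ i, (Y i).Nonempty)
    (hpi : PermInvariant Y u cls) (hx : IsSolution Y (Fjoint Y u cls) x) {t : ℝ} (ht : 0 ≤ t) :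
    ∀ᵐ s, s ∈ Set.Ioo 0 t →
      HasDerivAt (fun r ↦ U u (centroid cls (x r))) (gain hY u cls (x s)) s := by
  obtain ⟨hxD, g, hg, hgF, hxg⟩ := hx
  have hint : IntervalIntegrable g volume 0 t :=
    ((hg.integrableOn_compact_subset Set.Icc_subset_Ici_self isCompact_Icc).mono_set
      (by rw [Set.uIcc_of_le ht])).intervalIntegrable
  filter_upwards [(ae_restrict_iff' measurableSet_Ici).mp hgF, hint.ae_hasDerivAt_integral]
    with s hsF hsd hs
  have hs0 : 0 ≤ s := hs.1.le
  have hd : HasDerivAt x (g s) s := by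
    refine ((hsd ?_ 0 Set.left_mem_uIcc).const_add (x 0)).congr_of_eventuallyEq ?_
    · rw [Set.uIcc_of_le ht]
      exact Set.Ioo_subset_Icc_self hs
    · filter_upwards [Ioi_mem_nhds hs.1] with r hr
      rw [hxg r (le_of_lt hr), intervalIntegral.integral_of_le (le_of_lt hr)]
  rw [← linearDeriv_centroid_eq_gain hY hpi (hxD s hs0) (hsF hs0)]
  have hcd : HasDerivAt (fun r ↦ centroid cls (x r)) (centroidCLM cls (g s)) s := by
    simp only [← centroidCLM_apply]
    exact (centroidCLM cls).hasFDerivAt.comp_hasDerivAt s hd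
  exact (hasFDerivAt_U u (centroid cls (x s))).comp_hasDerivAt s hcd

theorem IsSolution.U_centroid_sub_eq_integral_gain [DecidableEq A] (hY : ∀ i, (Y i).Nonempty)
    (hpi : PermInvariant Y u cls) (hx : IsSolution Y (Fjoint Y u cls) x) {t : ℝ} (ht : 0 ≤ t) :
    U u (centroid cls (x t)) - U u (centroid cls (x 0)) =
      ∫ s in (0 : ℝ)..t, gain hY u cls (x s) := by
  obtain ⟨K, hK⟩ := (contDiff_U_centroid u cls).locallyLipschitz.locallyLipschitzOn
    (s := Metric.closedBall 0 1) |>.exists_lipschitzOnWith_of_compact (isCompact_closedBall _ _)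
  have hlip : LipschitzOnWith (K * 2) (fun r ↦ U u (centroid cls (x r))) (Set.uIcc 0 t) := by
    refine hK.comp (hx.lipschitzOnWith.mono ?_) fun r hr ↦ ?_
    · rw [Set.uIcc_of_le ht]
      exact Set.Icc_subset_Ici_self
    · rw [Set.uIcc_of_le ht] at hr
      exact mem_closedBall_zero_iff.mpr (norm_le_one_of_mem_Delta (hx.1 r hr.1))
  rw [← hlip.absolutelyContinuousOnInterval.integral_deriv_eq_sub]
  refine intervalIntegral.integral_congr_ae' ?_ ?_
  · filter_upwards [hx.ae_hasDerivAt hY hpi ht, volume.ae_ne t] with s hs hst hsI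
    exact (hs ⟨hsI.1, hsI.2.lt_of_ne hst⟩).deriv
  · simp [Set.Ioc_eq_empty_of_le ht]

end solution

variable [Nonempty ι]

/-- **Lemma 5(ii).** Every internally chain transitive set of the joint CT-ECFP inclusion
`q̇ ∈ BR(q̄) − q` is contained in MCE. -/
theorem chain_transitive_subset_MCE
    (Y : ι → Finset A) (hY : ∀ i, (Y i).Nonempty) (u : (ι → A) → ℝ)
    (cls : ι → κ) (hpi : PermInvariant Y u cls)
    (X : Set (ι → A → ℝ))
    (hX : InternallyChainTransitive Y (Fjoint Y u cls) X) :
    X ⊆ MCE Y u cls := by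
  classical
  obtain ⟨hcomp, hXD, hchain⟩ := hX
  intro ξ hξ
  refine mem_MCE_of_gain_eq_zero hY (hXD hξ) ?_
  refine eq_zero_of_chainTransitive_of_lyapunov hcomp
    ((continuous_U u).comp (continuous_centroid cls)) (continuous_gain hY u cls)
    (fun q hq ↦ gain_nonneg hY u cls (hXD hq)) ?_
    (fun x hx ↦ hx.lipschitzOnWith.continuousOn)
    (fun x hx t ht ↦ hx.U_centroid_sub_eq_integral_gain hY hpi ht) hchain ξ hξ
  refine (finite_image_U_NE Y u).subset ?_
  rintro _ ⟨q, ⟨hq, hq0⟩, rfl⟩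
  exact ⟨_, centroid_mem_NE_of_mem_MCE hpi (mem_MCE_of_gain_eq_zero hY (hXD hq) hq0), rfl⟩

end ECFP
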